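/- arXiv:1612.05892 — 2 statements merged into one kernel-verified Lean document; each statement's English description precedes it below -/
import Mathlib

section
/- Let (X,d) be a compact metric space and F = (f_n)_{n≥1} a sequence of homeomorphisms of X converging uniformly to a continuous map f : X → X. Then the pseudo-entropy of F is at most the classical topological entropy of f: h_p(F) ≤ h(f). -/
open Filter Topology Metric

/-- `orbitMap f n = f (n-1) ∘ ⋯ ∘ f 0`, i.e. the time-`n` map `F_n`. -/
def orbitMap {X : Type*} (f : ℕ → X → X) : ℕ → X → X
  | 0 => id
  | n + 1 => f n ∘ orbitMap f n

/-- Maximal cardinality of an `(n, F, ε)`-separated subset of `X`. -/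
noncomputable def sepCard {X : Type*} [MetricSpace X] (f : ℕ → X → X) (n : ℕ) (ε : ℝ) : ℕ :=
  sSup {k | ∃ E : Finset X,
    (∀ x ∈ E, ∀ y ∈ E, x ≠ y → ∃ j < n, ε < dist (orbitMap f j x) (orbitMap f j y)) ∧
    E.card = k}

/-- Topological entropy `h(F)` of the NDS `F`.  For a constant sequence
`f_n = g` this is the classical Bowen topological entropy of `g`. -/
noncomputable def ndsEntropy {X : Type*} [MetricSpace X] (f : ℕ → X → X) : ℝ :=
  ⨆ ε : {e : ℝ // 0 < e}, atTop.limsup fun n => Real.log (sepCard f n ε) / n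

/-- A bi-infinite `(α, F)`-pseudo-orbit of the NDS given by the homeomorphisms `f`. -/
def IsPseudoOrbit {X : Type*} [MetricSpace X] (f : ℕ → X ≃ₜ X) (α : ℝ) (x : ℤ → X) : Prop :=
  (∀ n : ℕ, dist (f n (x (n : ℤ))) (x ((n : ℤ) + 1)) < α) ∧
  (∀ m : ℕ, dist ((f m).symm (x (-(m : ℤ)))) (x (-(m : ℤ) - 1)) < α)

/-- `c_n(ε, α, F)`: maximal cardinality of an `(n, ε)`-separated set of
`(α, F)`-pseudo-orbits. -/
noncomputable def pseudoSepCard {X : Type*} [MetricSpace X] (f : ℕ → X ≃ₜ X)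
    (n : ℕ) (ε α : ℝ) : ℕ :=
  sSup {k | ∃ E : Finset (ℤ → X), (∀ x ∈ E, IsPseudoOrbit f α x) ∧
    (∀ x ∈ E, ∀ y ∈ E, x ≠ y → ∃ i < n, ε < dist (x (i : ℤ)) (y (i : ℤ))) ∧
    E.card = k}

/-- The pseudo-entropy `h_p(F)`. -/
noncomputable def pseudoEntropy {X : Type*} [MetricSpace X] (f : ℕ → X ≃ₜ X) : ℝ :=
  ⨆ ε : {e : ℝ // 0 < e}, ⨅ α : {a : ℝ // 0 < a},
    atTop.limsup fun n => Real.log (pseudoSepCard f n ε α) / n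

section Counting

variable {X : Type*} [MetricSpace X]

/-- A separated finite family injects into any space of itineraries fine enough to determine
its members up to the separation scale. -/
theorem card_le_of_itinerary {β γ : Type*} [Fintype γ] (E : Finset β) (u : β → ℕ → X)
    (n : ℕ) (ε : ℝ)
    (hsep : ∀ x ∈ E, ∀ y ∈ E, x ≠ y → ∃ i < n, ε < dist (u x i) (u y i))
    (φ : β → γ)
    (hφ : ∀ x ∈ E, ∀ y ∈ E, φ x = φ y → ∀ i < n, dist (u x i) (u y i) ≤ ε) :
    E.card ≤ Fintype.card γ := by
  rw [← Finset.card_univ]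
  refine Finset.card_le_card_of_injOn φ (fun _ _ => Finset.mem_coe.2 (Finset.mem_univ _)) ?_
  intro x hx y hy hxy
  by_contra hne
  obtain ⟨i, hi, hd⟩ := hsep x hx y hy hne
  exact absurd (hφ x hx y hy hxy i hi) (not_le.2 hd)

theorem exists_finite_coding [CompactSpace X] {ε : ℝ} (hε : 0 < ε) :
    ∃ (M : ℕ) (c : X → Fin M), 0 < M ∧ ∀ x y, c x = c y → dist x y ≤ ε := by
  obtain ⟨t, -, ht, hcov⟩ := (isCompact_univ (X := X)).finite_cover_balls (half_pos hε)
  have hex : ∀ x : X, ∃ z : t, dist x z < ε / 2 := by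
    intro x
    obtain ⟨z, hz, hxz⟩ := Set.mem_iUnion₂.1 (hcov (Set.mem_univ x))
    exact ⟨⟨z, hz⟩, hxz⟩
  choose c hc using hex
  have := ht.fintype
  refine ⟨Fintype.card t + 1, fun x => (Fintype.equivFin t (c x)).castSucc, Nat.succ_pos _, ?_⟩
  intro x y hxy
  have h : c x = c y := (Fintype.equivFin t).injective (Fin.castSucc_injective _ hxy)
  have hx := hc x
  have hy := hc y
  rw [← h] at hy
  linarith [dist_triangle_right x y (c x : X)]

/-- At every scale, families separated along `n` coordinates have at most exponentially
many members. -/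
theorem exists_card_le_pow [CompactSpace X] {ε : ℝ} (hε : 0 < ε) :
    ∃ M : ℕ, 0 < M ∧ ∀ (n : ℕ) {β : Type*} (E : Finset β) (u : β → ℕ → X),
      (∀ x ∈ E, ∀ y ∈ E, x ≠ y → ∃ i < n, ε < dist (u x i) (u y i)) → E.card ≤ M ^ n := by
  obtain ⟨M, c, hM, hc⟩ := exists_finite_coding (X := X) hε
  refine ⟨M, hM, fun n β E u hsep => ?_⟩
  have := card_le_of_itinerary E u n ε hsep (fun x (i : Fin n) => c (u x i))
    (fun x _ y _ hxy i hi => hc _ _ (congrFun hxy ⟨i, hi⟩))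
  simpa using this

theorem bddAbove_sepCard [CompactSpace X] (f : ℕ → X → X) (n : ℕ) {ε : ℝ} (hε : 0 < ε) :
    BddAbove {k | ∃ E : Finset X,
      (∀ x ∈ E, ∀ y ∈ E, x ≠ y → ∃ j < n, ε < dist (orbitMap f j x) (orbitMap f j y)) ∧
      E.card = k} := by
  obtain ⟨M, -, h⟩ := exists_card_le_pow (X := X) hε
  refine ⟨M ^ n, ?_⟩
  rintro k ⟨E, hE, rfl⟩
  exact h n E (fun x j => orbitMap f j x) hE

theorem exists_pseudoSepCard_bound [CompactSpace X] {ε : ℝ} (hε : 0 < ε) :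
    ∃ M : ℕ, 0 < M ∧ ∀ (f : ℕ → X ≃ₜ X) (n : ℕ) (α : ℝ),
      M ^ n ∈ upperBounds {k | ∃ E : Finset (ℤ → X), (∀ x ∈ E, IsPseudoOrbit f α x) ∧
        (∀ x ∈ E, ∀ y ∈ E, x ≠ y → ∃ i < n, ε < dist (x (i : ℤ)) (y (i : ℤ))) ∧
        E.card = k} := by
  obtain ⟨M, hM, h⟩ := exists_card_le_pow (X := X) hε
  refine ⟨M, hM, fun f n α => ?_⟩
  rintro k ⟨E, -, hE, rfl⟩
  exact h n E (fun x j => x (j : ℤ)) hE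

/-- A maximal separated set is spanning. -/
theorem exists_spanning [CompactSpace X] (f : ℕ → X → X) (m : ℕ) {δ : ℝ} (hδ : 0 < δ) :
    ∃ S : Finset X, S.card = sepCard f m δ ∧
      ∀ x, ∃ s ∈ S, ∀ j < m, dist (orbitMap f j x) (orbitMap f j s) ≤ δ := by
  classical
  have hb := bddAbove_sepCard f m hδ
  obtain ⟨S, hS, hcard⟩ := Nat.sSup_mem (by exact ⟨0, ∅, by simp, rfl⟩) hb
  refine ⟨S, hcard, fun x => ?_⟩
  by_contra! hx
  have hxS : x ∉ S := by
    intro hmem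
    obtain ⟨j, -, hj⟩ := hx x hmem
    rw [dist_self] at hj
    exact lt_asymm hδ hj
  have hle := le_csSup hb ⟨insert x S, by
    intro a ha b hb hab
    rcases Finset.mem_insert.1 ha with rfl | ha' <;>
      rcases Finset.mem_insert.1 hb with rfl | hb'
    · exact absurd rfl hab
    · exact hx b hb'
    · obtain ⟨j, hj, hd⟩ := hx a ha'
      exact ⟨j, hj, by rwa [dist_comm]⟩
    · exact hS a ha' b hb' hab, rfl⟩
  rw [Finset.card_insert_of_notMem hxS, ← hcard] at hle
  omega

end Counting

theorem limsup_div_le_of_eventually_le_affine {u : ℕ → ℝ} (hu : ∀ n, 0 ≤ u n) {A B : ℝ}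
    (h : ∀ᶠ n : ℕ in atTop, u n ≤ A + B * n) :
    atTop.limsup (fun n => u n / n) ≤ B := by
  refine le_of_forall_pos_le_add fun e he => ?_
  have hlim : Tendsto (fun n : ℕ => A / (n : ℝ)) atTop (𝓝 0) :=
    tendsto_const_div_atTop_nhds_zero_nat A
  refine limsup_le_of_le
    (isCoboundedUnder_le_of_le atTop (x := 0) fun n => div_nonneg (hu n) n.cast_nonneg) ?_
  filter_upwards [h, hlim.eventually (gt_mem_nhds he), eventually_gt_atTop 0] with n hn hA hpos
  have hn0 : (0 : ℝ) < n := Nat.cast_pos.2 hpos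
  rw [div_lt_iff₀ hn0] at hA
  rw [div_le_iff₀ hn0]
  linarith

section Entropy

variable {X : Type*} [MetricSpace X] [CompactSpace X]

theorem isBoundedUnder_log_pseudoSepCard (f : ℕ → X ≃ₜ X) {ε : ℝ} (hε : 0 < ε) (α : ℝ) :
    atTop.IsBoundedUnder (· ≤ ·) fun n : ℕ => Real.log (pseudoSepCard f n ε α) / n := by
  obtain ⟨M, hM, h⟩ := exists_pseudoSepCard_bound (X := X) hε
  refine isBoundedUnder_of ⟨Real.log M, fun n => ?_⟩
  have hle : pseudoSepCard f n ε α ≤ M ^ n := csSup_le ⟨0, ∅, by simp⟩ (h f n α)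
  refine div_le_of_le_mul₀ n.cast_nonneg (Real.log_natCast_nonneg M) ?_
  rcases Nat.eq_zero_or_pos (pseudoSepCard f n ε α) with h0 | h0
  · rw [h0, Nat.cast_zero, Real.log_zero]
    exact mul_nonneg (Real.log_natCast_nonneg M) n.cast_nonneg
  · calc Real.log (pseudoSepCard f n ε α) ≤ Real.log ((M : ℝ) ^ n) :=
          Real.log_le_log (Nat.cast_pos.2 h0) (by exact_mod_cast hle)
      _ = Real.log M * n := by rw [Real.log_pow, mul_comm]

theorem isBoundedUnder_log_sepCard (f : ℕ → X → X) {ε : ℝ} (hε : 0 < ε) :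
    atTop.IsBoundedUnder (· ≤ ·) fun n : ℕ => Real.log (sepCard f n ε) / n := by
  obtain ⟨M, hM, h⟩ := exists_card_le_pow (X := X) hε
  refine isBoundedUnder_of ⟨Real.log M, fun n => ?_⟩
  have hle : sepCard f n ε ≤ M ^ n := by
    refine csSup_le ⟨0, ∅, by simp⟩ ?_
    rintro k ⟨E, hE, rfl⟩
    exact h n E (fun x j => orbitMap f j x) hE
  refine div_le_of_le_mul₀ n.cast_nonneg (Real.log_natCast_nonneg M) ?_
  rcases Nat.eq_zero_or_pos (sepCard f n ε) with h0 | h0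
  · rw [h0, Nat.cast_zero, Real.log_zero]
    exact mul_nonneg (Real.log_natCast_nonneg M) n.cast_nonneg
  · calc Real.log (sepCard f n ε) ≤ Real.log ((M : ℝ) ^ n) :=
          Real.log_le_log (Nat.cast_pos.2 h0) (by exact_mod_cast hle)
      _ = Real.log M * n := by rw [Real.log_pow, mul_comm]

theorem bddBelow_pseudoSepCard_rate (f : ℕ → X ≃ₜ X) {ε : ℝ} (hε : 0 < ε) :
    BddBelow (Set.range fun α : {a : ℝ // 0 < a} =>
      atTop.limsup fun n : ℕ => Real.log (pseudoSepCard f n ε α) / n) := by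
  refine ⟨0, ?_⟩
  rintro _ ⟨α, rfl⟩
  exact le_limsup_of_frequently_le
    (Frequently.of_forall fun n => div_nonneg (Real.log_natCast_nonneg _) n.cast_nonneg)
    (isBoundedUnder_log_pseudoSepCard f hε α)

/-- Over a bounded number of steps, pseudo-orbits of a continuous map stay close to orbits. -/
theorem exists_pseudoOrbit_close {g : X → X} (hg : Continuous g) (m : ℕ) :
    ∀ δ > 0, ∃ α > 0, ∀ y : ℕ → X, (∀ i, dist (g (y i)) (y (i + 1)) < α) →
      ∀ j ≤ m, dist (y j) (orbitMap (fun _ => g) j (y 0)) ≤ δ := by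
  induction m with
  | zero =>
    intro δ hδ
    refine ⟨1, one_pos, fun y _ j hj => ?_⟩
    obtain rfl : j = 0 := by omega
    simpa [orbitMap] using hδ.le
  | succ m ih =>
    intro δ hδ
    obtain ⟨η, hη, hgη⟩ := Metric.uniformContinuous_iff.1
      (CompactSpace.uniformContinuous_of_continuous hg) (δ / 2) (half_pos hδ)
    obtain ⟨α, hα, H⟩ := ih (min (η / 2) δ) (lt_min (half_pos hη) hδ)
    refine ⟨min α (δ / 2), lt_min hα (half_pos hδ), fun y hy j hj => ?_⟩
    have Hy := H y fun i => (hy i).trans_le (min_le_left _ _)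
    rcases Nat.lt_or_ge m j with hlt | hle
    · obtain rfl : j = m + 1 := by omega
      have h1 : dist (y m) (orbitMap (fun _ => g) m (y 0)) < η :=
        ((Hy m le_rfl).trans (min_le_left _ _)).trans_lt (half_lt_self hη)
      have h2 := hgη h1
      have h3 := (hy m).trans_le (min_le_right _ _)
      rw [dist_comm] at h3
      change dist (y (m + 1)) (g (orbitMap (fun _ => g) m (y 0))) ≤ δ
      linarith [dist_triangle (y (m + 1)) (g (y m)) (g (orbitMap (fun _ => g) m (y 0)))]
    · exact (Hy j hle).trans (min_le_right _ _)

theorem pseudoSepCard_rate_le (f : ℕ → X ≃ₜ X) {g : X → X} (hg : Continuous g)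
    (hconv : TendstoUniformly (fun n => (f n : X → X)) g atTop) {ε : ℝ} (hε : 0 < ε) :
    (⨅ α : {a : ℝ // 0 < a}, atTop.limsup fun n : ℕ => Real.log (pseudoSepCard f n ε α) / n) ≤
      atTop.limsup fun n : ℕ => Real.log (sepCard (fun _ => g) n (ε / 4)) / n := by
  have hδ : 0 < ε / 4 := by positivity
  refine le_of_forall_pos_le_add fun e he => ?_
  obtain ⟨m, hm, hm0⟩ := ((eventually_lt_of_limsup_lt (lt_add_of_pos_right _ he)
    (isBoundedUnder_log_sepCard (fun _ => g) hδ)).and (eventually_gt_atTop 0)).exists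
  refine le_trans ?_ hm.le
  obtain ⟨S, hScard, hS⟩ := exists_spanning (fun _ => g) m hδ
  rw [← hScard]
  obtain ⟨α, hα, hclose⟩ := exists_pseudoOrbit_close hg m (ε / 4) hδ
  obtain ⟨N, hN⟩ := eventually_atTop.1
    (Metric.tendstoUniformly_iff.1 hconv (α / 2) (half_pos hα))
  obtain ⟨M, c, hM, hc⟩ := exists_finite_coding (X := X) hε
  refine (ciInf_le (bddBelow_pseudoSepCard_rate f hε) ⟨α / 2, half_pos hα⟩).trans ?_
  choose s hsS hs using hS
  have hcount : ∀ n, pseudoSepCard f n ε (α / 2) ≤ M ^ N * S.card ^ (n / m + 1) := by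
    intro n
    refine csSup_le ⟨0, ∅, by simp⟩ ?_
    rintro k ⟨E, hE, hsep, rfl⟩
    have key := card_le_of_itinerary (γ := (Fin N → Fin M) × (Fin (n / m + 1) → S)) E
      (fun x i => x (i : ℤ)) n ε hsep
      (fun x => (fun i => c (x ((i : ℕ) : ℤ)),
        fun k => ⟨s (x ((N + k * m : ℕ) : ℤ)), hsS _⟩)) ?_
    · simpa using key
    intro x hx y hy hxy i hi
    obtain ⟨h1, h2⟩ := Prod.ext_iff.1 hxy
    rcases Nat.lt_or_ge i N with hiN | hiN
    · exact hc _ _ (congrFun h1 ⟨i, hiN⟩)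
    set q := (i - N) / m with hq
    set r := (i - N) % m with hr
    have hir : i = N + q * m + r := by
      have h := Nat.div_add_mod' (i - N) m
      rw [← hq, ← hr] at h
      omega
    have hrm : r < m := Nat.mod_lt _ hm0
    have hqn : q < n / m + 1 :=
      Nat.lt_succ_of_le (Nat.div_le_div_right (by omega))
    have hsxy : s (x ((N + q * m : ℕ) : ℤ)) = s (y ((N + q * m : ℕ) : ℤ)) :=
      congrArg Subtype.val (congrFun h2 ⟨q, hqn⟩)
    have hfollow : ∀ z ∈ E, dist (z (i : ℤ))
        (orbitMap (fun _ => g) r (s (z ((N + q * m : ℕ) : ℤ)))) ≤ ε / 4 + ε / 4 := by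
      intro z hz
      have hz1 := hclose (fun l => z ((N + q * m + l : ℕ) : ℤ)) (fun l => by
        have ha := hN (N + q * m + l) (by omega) (z ((N + q * m + l : ℕ) : ℤ))
        have hb := (hE z hz).1 (N + q * m + l)
        have hcast : ((N + q * m + (l + 1) : ℕ) : ℤ) = ((N + q * m + l : ℕ) : ℤ) + 1 := by
          push_cast; ring
        simp only [hcast]
        exact (dist_triangle _ _ _).trans_lt ((add_lt_add ha hb).trans_eq (add_halves α)))
        r hrm.le
      have hz2 := hs (z ((N + q * m : ℕ) : ℤ)) r hrm
      simp only [← hir, add_zero] at hz1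
      exact (dist_triangle _ _ _).trans (add_le_add hz1 hz2)
    have hxf := hfollow x hx
    have hyf := hfollow y hy
    rw [← hsxy] at hyf
    have := dist_triangle_right (x (i : ℤ)) (y (i : ℤ))
      (orbitMap (fun _ => g) r (s (x ((N + q * m : ℕ) : ℤ))))
    linarith
  refine limsup_div_le_of_eventually_le_affine (fun n => Real.log_natCast_nonneg _)
    (A := N * Real.log M + Real.log S.card) (Eventually.of_forall fun n => ?_)
  have hlS := Real.log_natCast_nonneg S.card
  have hlM := Real.log_natCast_nonneg M
  have hdiv : ((n / m : ℕ) : ℝ) * Real.log S.card ≤ Real.log S.card / m * n := by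
    calc ((n / m : ℕ) : ℝ) * Real.log S.card ≤ (n / m : ℝ) * Real.log S.card :=
          mul_le_mul_of_nonneg_right Nat.cast_div_le hlS
      _ = Real.log S.card / m * n := by ring
  rcases Nat.eq_zero_or_pos (pseudoSepCard f n ε (α / 2)) with h0 | h0
  · simp only [h0, Nat.cast_zero, Real.log_zero]
    positivity
  · have hS0 : S.card ≠ 0 := by
      intro hz
      have := h0.trans_le (hcount n)
      simp [hz] at this
    have hlog : Real.log (pseudoSepCard f n ε (α / 2)) ≤
        Real.log ((M : ℝ) ^ N * (S.card : ℝ) ^ (n / m + 1)) :=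
      Real.log_le_log (Nat.cast_pos.2 h0) (by exact_mod_cast hcount n)
    rw [Real.log_mul (pow_ne_zero _ (Nat.cast_ne_zero.2 hM.ne'))
      (pow_ne_zero _ (Nat.cast_ne_zero.2 hS0)), Real.log_pow, Real.log_pow] at hlog
    rw [Nat.cast_add, Nat.cast_one] at hlog
    simp only
    linarith

theorem surjective_orbitMap {Y : Type*} {f : ℕ → Y → Y} (hf : ∀ n, Function.Surjective (f n))
    (n : ℕ) : Function.Surjective (orbitMap f n) := by
  induction n with
  | zero => exact Function.surjective_id
  | succ n ih => exact (hf n).comp ih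

/-- A pseudo-orbit which follows the orbit of `x` under `g` from time `N` on. -/
theorem exists_pseudoOrbit_eq_orbitMap {X : Type*} [MetricSpace X] (f : ℕ → X ≃ₜ X) (g : X → X)
    {α : ℝ} (hα : 0 < α) {N : ℕ} (hN : ∀ n ≥ N, ∀ x, dist (g x) (f n x) < α) (x : X) :
    ∃ y : ℤ → X, IsPseudoOrbit f α y ∧
      ∀ j : ℕ, y ((j + N : ℕ) : ℤ) = orbitMap (fun _ => g) j x := by
  obtain ⟨p, hp⟩ := surjective_orbitMap (f := fun n => (f n : X → X))
    (fun n => (f n).surjective) N x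
  let z : ℕ → X := fun k =>
    if k < N then orbitMap (fun n => (f n : X → X)) k p else orbitMap (fun _ => g) (k - N) x
  let b : ℕ → X := fun m => orbitMap (fun n => ((f n).symm : X → X)) m p
  have hz0 : z 0 = b 0 := by
    rcases Nat.eq_zero_or_pos N with rfl | h
    · exact hp.symm
    · exact if_pos h
  let y : ℤ → X := fun k => if 0 ≤ k then z k.toNat else b (-k).toNat
  have hy : ∀ k : ℕ, y (k : ℤ) = z k := fun k => by simp [y]
  have hyb : ∀ k : ℕ, y (-(k : ℤ)) = b k := fun k => by
    rcases Nat.eq_zero_or_pos k with rfl | h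
    · simp [y, hz0]
    · have : ¬ (0 : ℤ) ≤ -(k : ℤ) := by omega
      simp only [y, if_neg this, neg_neg, Int.toNat_natCast]
  refine ⟨y, ⟨fun n => ?_, fun m => ?_⟩, fun j => ?_⟩
  · have h := hy (n + 1)
    push_cast at h
    rw [h, hy]
    rcases lt_trichotomy (n + 1) N with hn | hn | hn
    · simpa [z, hn, Nat.lt_of_succ_lt hn, orbitMap] using hα
    · subst hn
      have : z (n + 1) = f n (z n) := by
        simp only [z, lt_irrefl, if_false, Nat.lt_succ_self, if_true, Nat.sub_self]
        exact hp.symm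
      rwa [this, dist_self]
    · have h1 : ¬ n < N := by omega
      have h2 : ¬ n + 1 < N := by omega
      have h3 : n + 1 - N = n - N + 1 := by omega
      simp only [z, if_neg h1, if_neg h2, h3]
      rw [dist_comm]
      exact hN n (by omega) _
  · have h : -(m : ℤ) - 1 = -((m + 1 : ℕ) : ℤ) := by push_cast; ring
    rw [h, hyb, hyb]
    simpa [b, orbitMap] using hα
  · rw [hy]
    simp [z]

theorem sepCard_rate_le (f : ℕ → X ≃ₜ X) {g : X → X}
    (hconv : TendstoUniformly (fun n => (f n : X → X)) g atTop) {ε : ℝ} (hε : 0 < ε) :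
    (atTop.limsup fun n : ℕ => Real.log (sepCard (fun _ => g) n ε) / n) ≤
      ⨅ α : {a : ℝ // 0 < a}, atTop.limsup fun n : ℕ => Real.log (pseudoSepCard f n ε α) / n := by
  classical
  have : Nonempty {a : ℝ // 0 < a} := ⟨⟨1, one_pos⟩⟩
  refine le_ciInf fun ⟨α, hα⟩ => ?_
  obtain ⟨N, hN⟩ := eventually_atTop.1 (Metric.tendstoUniformly_iff.1 hconv α hα)
  choose Y hY hYg using exists_pseudoOrbit_eq_orbitMap f g hα hN
  have hcount : ∀ n, sepCard (fun _ => g) n ε ≤ pseudoSepCard f (n + N) ε α := by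
    intro n
    refine csSup_le ⟨0, ∅, by simp⟩ ?_
    rintro k ⟨E, hE, rfl⟩
    obtain ⟨M, -, hM⟩ := exists_pseudoSepCard_bound (X := X) hε
    have hinj : Function.Injective Y := by
      intro a b hab
      have := hYg a 0
      rw [hab, hYg b 0] at this
      exact this.symm
    refine le_csSup ⟨_, hM f (n + N) α⟩ ⟨E.image Y, ?_, ?_, Finset.card_image_of_injective E hinj⟩
    · simp only [Finset.mem_image]
      rintro _ ⟨a, -, rfl⟩
      exact hY a
    · simp only [Finset.mem_image]
      rintro _ ⟨a, ha, rfl⟩ _ ⟨b, hb, rfl⟩ hab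
      obtain ⟨j, hj, hd⟩ := hE a ha b hb (fun h => hab (congrArg Y h))
      exact ⟨j + N, by omega, by rwa [hYg, hYg]⟩
  refine le_of_forall_gt_imp_ge_of_dense fun L hL => ?_
  have hev := eventually_lt_of_limsup_lt hL (isBoundedUnder_log_pseudoSepCard f hε α)
  refine limsup_div_le_of_eventually_le_affine (fun n => Real.log_natCast_nonneg _)
    (A := L * N) ?_
  filter_upwards [(tendsto_add_atTop_nat N).eventually hev, eventually_gt_atTop 0] with n hn hn0
  have hpos : (0 : ℝ) < (n + N : ℕ) := Nat.cast_pos.2 (by omega)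
  rw [div_lt_iff₀ hpos] at hn
  push_cast at hn
  have hlog : Real.log (sepCard (fun _ => g) n ε) ≤ Real.log (pseudoSepCard f (n + N) ε α) := by
    rcases Nat.eq_zero_or_pos (sepCard (fun _ => g) n ε) with h0 | h0
    · rw [h0, Nat.cast_zero, Real.log_zero]
      exact Real.log_natCast_nonneg _
    · exact Real.log_le_log (Nat.cast_pos.2 h0) (Nat.cast_le.2 (hcount n))
  linarith

end Entropy

/-- If the homeomorphisms `f_n` converge uniformly to the continuous map `g`,
then `h_p(F) ≤ h(g)`, where `h(g)` is the classical Bowen topological entropy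
of `g` (the entropy of the constant sequence `g, g, g, …`). -/
theorem pseudoEntropy_le_of_tendstoUniformly
    {X : Type*} [MetricSpace X] [CompactSpace X] (f : ℕ → X ≃ₜ X)
    (g : X → X) (hg : Continuous g)
    (hconv : TendstoUniformly (fun n => (f n : X → X)) g atTop) :
    pseudoEntropy f ≤ ndsEntropy (fun _ => g) := by
  have : Nonempty {e : ℝ // 0 < e} := ⟨⟨1, one_pos⟩⟩
  unfold pseudoEntropy ndsEntropy
  by_cases hb : BddAbove (Set.range fun ε : {e : ℝ // 0 < e} =>
      atTop.limsup fun n : ℕ => Real.log (sepCard (fun _ => g) n ε) / n)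
  · exact ciSup_le fun ⟨ε, hε⟩ => (pseudoSepCard_rate_le f hg hconv hε).trans
      (le_ciSup hb ⟨ε / 4, by positivity⟩)
  · -- both suprema are infinite, hence both take the default value
    rw [Real.iSup_of_not_bddAbove hb, Real.iSup_of_not_bddAbove]
    refine fun hb' => hb (hb'.range_mono _ fun ε => ?_)
    exact sepCard_rate_le f hconv ε.2
end

section
/- Let (X,d) be a compact metric space with diameter D and (X,F) a chain mixing non-autonomous dynamical system that is Lipschitz with Lipschitz constant c. Then for all sufficiently small δ > 0 and all 0 < ε < δ: if c > 1 then the chain mixing time satisfies m_ε(δ,F) ≥ log_c( (D(c−1)+2ε) / (2δ(c−1)+2ε) ), and if c = 1 then m_ε(δ,F) ≥ (D − 2δ)/(2ε). -/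
open Filter Topology Metric

/-- An `(ε, F)`-chain of length `n` from `x` to `y`. -/
def IsChainFromTo {X : Type*} [MetricSpace X] (f : ℕ → X → X) (ε : ℝ) (n : ℕ)
    (x y : X) : Prop :=
  ∃ c : ℕ → X, c 0 = x ∧ c n = y ∧ ∀ i < n, dist (f i (c i)) (c (i + 1)) < ε

/-- The NDS `(X, F)` is chain mixing: for every `ε > 0` there is `N` such that
any two points are joined by an `(ε, F)`-chain of length exactly `n`, for every
`n ≥ N`. -/
def ChainMixing {X : Type*} [MetricSpace X] (f : ℕ → X → X) : Prop :=
  ∀ ε > (0 : ℝ), ∃ N : ℕ, ∀ n ≥ N, ∀ x y : X, IsChainFromTo f ε n x y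

/-- The NDS `F` is Lipschitz with Lipschitz constant `c`. -/
def LipschitzNDS {X : Type*} [MetricSpace X] (f : ℕ → X → X) (c : ℝ) : Prop :=
  ∀ n : ℕ, ∀ x y : X, dist (f n x) (f n y) ≤ c * dist x y

/-- The chain mixing time `m_ε(x, δ, F)`: the smallest `N` such that for any
`n ≥ N` and any `y` there is an `(ε, F)`-chain of length exactly `n` from some
point of `B_δ(x)` to `y`. -/
noncomputable def mixTimeAt {X : Type*} [MetricSpace X] (f : ℕ → X → X)
    (ε δ : ℝ) (x : X) : ℕ :=
  sInf {N | ∀ n ≥ N, ∀ y : X, ∃ z ∈ Metric.ball x δ, IsChainFromTo f ε n z y}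

/-- The chain mixing time `m_ε(δ, F) = max_{x ∈ X} m_ε(x, δ, F)`. -/
noncomputable def mixTime {X : Type*} [MetricSpace X] (f : ℕ → X → X)
    (ε δ : ℝ) : ℕ :=
  sSup (Set.range (mixTimeAt f ε δ))

/-- The exact orbit of `x` under the NDS `F`. -/
def orbitNDS {X : Type*} (f : ℕ → X → X) (x : X) : ℕ → X
  | 0 => x
  | n + 1 => f n (orbitNDS f x n)

lemma dist_orbitNDS_le {X : Type*} [MetricSpace X] {f : ℕ → X → X} {c ε δ : ℝ} {n : ℕ}
    {x z y : X} (hc : 0 ≤ c) (hlip : LipschitzNDS f c) (hz : dist z x ≤ δ)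
    (h : IsChainFromTo f ε n z y) :
    dist y (orbitNDS f x n) ≤ c ^ n * δ + ε * ∑ i ∈ Finset.range n, c ^ i := by
  obtain ⟨u, rfl, rfl, hu⟩ := h
  induction n with
  | zero => simpa [orbitNDS] using hz
  | succ n ih =>
    have h1 := mul_le_mul_of_nonneg_left (ih fun i hi => hu i (by omega)) hc
    have h2 := hlip n (u n) (orbitNDS f x n)
    have h3 := hu n (by omega)
    have h4 := dist_triangle_left (u (n + 1)) (orbitNDS f x (n + 1)) (f n (u n))
    rw [geom_sum_succ, pow_succ]
    simp only [orbitNDS] at h4 ⊢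
    linarith

lemma exists_chain_of_mixTime {X : Type*} [MetricSpace X] {f : ℕ → X → X} (hmix : ChainMixing f)
    {ε δ : ℝ} (hε : 0 < ε) (hδ : 0 < δ) (x y : X) :
    ∃ z ∈ Metric.ball x δ, IsChainFromTo f ε (mixTime f ε δ) z y := by
  obtain ⟨N, hN⟩ := hmix ε hε
  have hmem (w : X) :
      N ∈ {N | ∀ n ≥ N, ∀ y : X, ∃ z ∈ Metric.ball w δ, IsChainFromTo f ε n z y} :=
    fun n hn y => ⟨w, Metric.mem_ball_self hδ, hN n hn w y⟩
  have hbdd : BddAbove (Set.range (mixTimeAt f ε δ)) :=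
    ⟨N, by rintro _ ⟨w, rfl⟩; exact Nat.sInf_le (hmem w)⟩
  exact Nat.sInf_mem ⟨N, hmem x⟩ _ (le_csSup hbdd (Set.mem_range_self x)) y

lemma diam_le_of_mixTime {X : Type*} [MetricSpace X] {f : ℕ → X → X} {c ε δ : ℝ}
    (hmix : ChainMixing f) (hc : 0 ≤ c) (hlip : LipschitzNDS f c) (hε : 0 < ε) (hδ : 0 < δ) :
    Metric.diam (Set.univ : Set X) ≤
      2 * (c ^ mixTime f ε δ * δ + ε * ∑ i ∈ Finset.range (mixTime f ε δ), c ^ i) := by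
  refine Metric.diam_le_of_forall_dist_le (by positivity) fun y _ y' _ => ?_
  obtain ⟨z, hz, hzy⟩ := exists_chain_of_mixTime hmix hε hδ y y
  obtain ⟨z', hz', hzy'⟩ := exists_chain_of_mixTime hmix hε hδ y y'
  have h1 := dist_orbitNDS_le hc hlip (Metric.mem_ball.mp hz).le hzy
  have h2 := dist_orbitNDS_le hc hlip (Metric.mem_ball.mp hz').le hzy'
  have h3 := dist_triangle_right y y' (orbitNDS f y (mixTime f ε δ))
  linarith

/-- For a chain mixing Lipschitz NDS with constant `c` on a compact metric space
of diameter `D`, for `δ` sufficiently small and `0 < ε < δ`: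
`m_ε(δ,F) ≥ log_c((D(c-1)+2ε)/(2δ(c-1)+2ε))` if `c > 1`, and
`m_ε(δ,F) ≥ (D-2δ)/(2ε)` if `c = 1`. -/
theorem mixTime_lower_bound
    {X : Type*} [MetricSpace X] [CompactSpace X] (f : ℕ → X → X)
    (hf : ∀ n, Continuous (f n)) (c : ℝ)
    (hmix : ChainMixing f) (hlip : LipschitzNDS f c) :
    ∃ δ₀ > (0 : ℝ), ∀ δ : ℝ, 0 < δ → δ < δ₀ → ∀ ε : ℝ, 0 < ε → ε < δ →
      (1 < c →
        Real.logb c ((Metric.diam (Set.univ : Set X) * (c - 1) + 2 * ε) /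
            (2 * δ * (c - 1) + 2 * ε)) ≤ (mixTime f ε δ : ℝ)) ∧
      (c = 1 →
        (Metric.diam (Set.univ : Set X) - 2 * δ) / (2 * ε) ≤ (mixTime f ε δ : ℝ)) := by
  refine ⟨1, one_pos, fun δ hδ _ ε hε _ => ⟨fun hc => ?_, ?_⟩⟩
  · have hD := diam_le_of_mixTime hmix (by linarith) hlip hε hδ
    have hc' : 0 < c - 1 := sub_pos.mpr hc
    have hgeom := geom_sum_mul c (mixTime f ε δ)
    have hnum : 0 < Metric.diam (Set.univ : Set X) * (c - 1) + 2 * ε := by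
      have := mul_nonneg (Metric.diam_nonneg (s := (Set.univ : Set X))) hc'.le
      linarith
    have hden : 0 < 2 * δ * (c - 1) + 2 * ε := by positivity
    rw [Real.logb_le_iff_le_rpow hc (div_pos hnum hden), Real.rpow_natCast, div_le_iff₀ hden]
    linear_combination (c - 1) * hD + 2 * ε * hgeom
  · rintro rfl
    have hD := diam_le_of_mixTime hmix zero_le_one hlip hε hδ
    simp only [one_pow, Finset.sum_const, Finset.card_range, nsmul_eq_mul] at hD
    rw [div_le_iff₀ (by positivity)]
    linarith
end
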